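/- The permutation-switch count SC_T and the action-switching count S_T := |{t : a_{t+1}^⋆ ≠ a_t^⋆}| (where a_t^⋆ is the round-t optimal subset) are incomparable: (a) there exists a sequence of submodular–concave games with SC_T = 0 and S_T = T − 1; and (b) there exists a sequence of submodular–concave games with S_T = 0 and SC_T = T − 1. -/

import Mathlib

open scoped BigOperators

noncomputable section

/-- Submodularity of a set function on the ground set `Fin n`. -/
def Submodular {n : ℕ} (f : Finset (Fin n) → ℝ) : Prop :=
  ∀ S T : Finset (Fin n), f (S ∪ T) + f (S ∩ T) ≤ f S + f T

/-- The chain set `C_i = {σ(0), …, σ(i-1)}` determined by a permutation `σ`. -/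
def chainOf {n : ℕ} (σ : Equiv.Perm (Fin n)) (i : ℕ) : Finset (Fin n) :=
  (Finset.univ.filter fun k : Fin n => (k : ℕ) < i).image σ

/-- The permutation sorting `x` in descending order (deterministic tie-breaking). -/
def sortPerm {n : ℕ} (x : Fin n → ℝ) : Equiv.Perm (Fin n) :=
  Tuple.sort (fun i => -x i)

/-- Sorted values `x_{π(i)}`, with the conventions `x_{π(0)} = 1` and `x_{π(n+1)} = 0`. -/
def sortedVal {n : ℕ} (x : Fin n → ℝ) (i : ℕ) : ℝ :=
  if _h0 : i = 0 then 1
  else if h : i ≤ n then x (sortPerm x ⟨i - 1, by omega⟩) else 0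

/-- The Lovász extension `f_L(x) = ∑_{i=0}^n (x_{π(i)} − x_{π(i+1)}) f(C_i)`. -/
def lovasz {n : ℕ} (f : Finset (Fin n) → ℝ) (x : Fin n → ℝ) : ℝ :=
  ∑ i ∈ Finset.range (n + 1),
    (sortedVal x i - sortedVal x (i + 1)) * f (chainOf (sortPerm x) i)

/-- Two-argument Lovász extension of a payoff `f : 2^{[n]} × Y → ℝ`. -/
def lovaszG {n m : ℕ} (f : Finset (Fin n) → (Fin m → ℝ) → ℝ)
    (x : Fin n → ℝ) (y : Fin m → ℝ) : ℝ :=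
  lovasz (fun S => f S y) x

/-- The unit cube `[0,1]^n`. -/
def cube (n : ℕ) : Set (Fin n → ℝ) := Set.Icc (0 : Fin n → ℝ) 1

lemma chainOf_zero {n : ℕ} (σ : Equiv.Perm (Fin n)) : chainOf σ 0 = ∅ := by
  simp [chainOf]

lemma chainOf_succ {n : ℕ} (σ : Equiv.Perm (Fin n)) (i : Fin n) :
    chainOf σ (i + 1) = insert (σ i) (chainOf σ i) := by
  ext j
  simp only [chainOf, Finset.mem_image, Finset.mem_filter, Finset.mem_univ, true_and,
    Finset.mem_insert]
  constructor
  · rintro ⟨k, hk, rfl⟩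
    rcases Nat.lt_succ_iff_lt_or_eq.mp hk with h | h
    · exact Or.inr ⟨k, h, rfl⟩
    · exact Or.inl (congrArg σ (Fin.ext h))
  · rintro (rfl | ⟨k, hk, rfl⟩)
    · exact ⟨i, Nat.lt_succ_self _, rfl⟩
    · exact ⟨k, Nat.lt_succ_of_lt hk, rfl⟩

lemma notMem_chainOf {n : ℕ} (σ : Equiv.Perm (Fin n)) (i : Fin n) : σ i ∉ chainOf σ i := by
  simp [chainOf]

lemma sum_range_sub_mul (s F : ℕ → ℝ) (n : ℕ) :
    ∑ i ∈ Finset.range (n + 1), (s i - s (i + 1)) * F i =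
      s 0 * F 0 + ∑ i ∈ Finset.range n, s (i + 1) * (F (i + 1) - F i) - s (n + 1) * F n := by
  induction n with
  | zero => simp; ring
  | succ n ih => rw [Finset.sum_range_succ, ih, Finset.sum_range_succ _ n]; ring

/-- The Lovász extension of a modular function is the affine function with the same weights. -/
lemma lovasz_modular {n : ℕ} (c : ℝ) (w x : Fin n → ℝ) :
    lovasz (fun S => c + ∑ i ∈ S, w i) x = c + ∑ i, w i * x i := by
  have hlast : sortedVal x (n + 1) = 0 := by simp [sortedVal]
  rw [lovasz, sum_range_sub_mul, hlast, chainOf_zero, ← Equiv.sum_comp (sortPerm x),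
    Finset.sum_range]
  have hterm (i : Fin n) : sortedVal x (i + 1) *
      ((c + ∑ j ∈ chainOf (sortPerm x) (i + 1), w j) - (c + ∑ j ∈ chainOf (sortPerm x) i, w j)) =
      w (sortPerm x i) * x (sortPerm x i) := by
    have hval : sortedVal x (i + 1) = x (sortPerm x i) := by
      simp [sortedVal]
    rw [hval, chainOf_succ, Finset.sum_insert (notMem_chainOf _ _)]
    ring
  rw [Finset.sum_congr rfl fun i _ => hterm i]
  simp [sortedVal]

lemma submodular_modular {n : ℕ} (c : ℝ) (w : Fin n → ℝ) :
    Submodular (fun S => c + ∑ i ∈ S, w i) := by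
  intro S T
  have := Finset.sum_union_inter (s₁ := S) (s₂ := T) (f := w)
  dsimp only
  linarith

lemma le_apply_sortPerm {n : ℕ} (x : Fin n → ℝ) {i j : Fin n} (hij : i ≤ j) :
    x (sortPerm x j) ≤ x (sortPerm x i) :=
  neg_le_neg_iff.mp (Tuple.monotone_sort (fun i => -x i) hij)

lemma sortPerm_ne_of_opposite_order {x x' : Fin 2 → ℝ}
    (h : (x 0 < x 1 ∧ x' 1 < x' 0) ∨ (x 1 < x 0 ∧ x' 0 < x' 1)) :
    sortPerm x' ≠ sortPerm x := by
  intro heq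
  have hx := le_apply_sortPerm x (show (0 : Fin 2) ≤ 1 by decide)
  have hx' := le_apply_sortPerm x' (show (0 : Fin 2) ≤ 1 by decide)
  rw [heq] at hx'
  have hne : sortPerm x 0 ≠ sortPerm x 1 := (sortPerm x).injective.ne (by decide)
  generalize sortPerm x 0 = a at *
  generalize sortPerm x 1 = b at *
  fin_cases a <;> fin_cases b <;> simp at hx hx' hne <;> rcases h with h | h <;> linarith

/-- Two interior target points whose coordinates are swapped from one round to the next. -/
def alternatingPoint (t : ℕ) : Fin 2 → ℝ :=
  if Even t then ![1 / 3, 1 / 4] else ![1 / 4, 1 / 3]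

/-- The bilinear payoff `⟨y, χ_S - p⟩`, whose Lovász extension has the saddle point `(p, 0)`. -/
def offsetPayoff {n : ℕ} (p : Fin n → ℝ) (S : Finset (Fin n)) (y : Fin n → ℝ) : ℝ :=
  -∑ i, p i * y i + ∑ i ∈ S, y i

lemma lovaszG_offsetPayoff {n : ℕ} (p x y : Fin n → ℝ) :
    lovaszG (offsetPayoff p) x y = -∑ i, p i * y i + ∑ i, y i * x i :=
  lovasz_modular _ y x

lemma concaveOn_offsetPayoff {n : ℕ} (p : Fin n → ℝ) (S : Finset (Fin n)) {Y : Set (Fin n → ℝ)}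
    (hY : Convex ℝ Y) : ConcaveOn ℝ Y (offsetPayoff p S) := by
  refine ⟨hY, fun u _ v _ a b _ _ _ => le_of_eq ?_⟩
  simp only [offsetPayoff, smul_eq_mul, Pi.add_apply, Pi.smul_apply, mul_add,
    Finset.sum_add_distrib, mul_neg, Finset.mul_sum, mul_left_comm]
  ring

lemma continuous_offsetPayoff {n : ℕ} (p : Fin n → ℝ) (S : Finset (Fin n)) :
    Continuous (offsetPayoff p S) := by
  unfold offsetPayoff
  fun_prop

/-- If all coordinates of `p` lie in `[0, 1/2)`, the empty set is the unique minimizer of the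
worst-case payoff over the box `[-1, 1]^n`. -/
lemma sSup_offsetPayoff_empty_lt {n : ℕ} {p : Fin n → ℝ} (hp0 : ∀ i, 0 ≤ p i)
    (hp : ∀ i, p i < 1 / 2) {S : Finset (Fin n)} (hS : S ≠ ∅) :
    sSup (offsetPayoff p ∅ '' Set.Icc (-1) 1) < sSup (offsetPayoff p S '' Set.Icc (-1) 1) := by
  have hub : sSup (offsetPayoff p ∅ '' Set.Icc (-1) 1) ≤ ∑ i, p i := by
    refine csSup_le (Set.Nonempty.image _ ⟨1, by simp [Pi.le_def]⟩) ?_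
    rintro _ ⟨y, hy, rfl⟩
    simp only [offsetPayoff, Finset.sum_empty, add_zero, ← Finset.sum_neg_distrib]
    refine Finset.sum_le_sum fun i _ => ?_
    have hyi : -1 ≤ y i := hy.1 i
    nlinarith [hp0 i]
  set y : Fin n → ℝ := fun i => if i ∈ S then 1 else -1 with hy
  have hyY : y ∈ Set.Icc (-1 : Fin n → ℝ) 1 := by
    constructor <;> intro i <;> by_cases hi : i ∈ S <;> simp [hy, hi]
  have hval : offsetPayoff p S y = ∑ i, (if i ∈ S then 1 - p i else p i) := by
    have hsum : ∑ i ∈ S, y i = ∑ i, if i ∈ S then y i else 0 := by simp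
    rw [offsetPayoff, hsum, ← Finset.sum_neg_distrib, ← Finset.sum_add_distrib]
    refine Finset.sum_congr rfl fun i _ => ?_
    by_cases hi : i ∈ S <;> simp [hy, hi]
    ring
  have hlt : ∑ i, p i < offsetPayoff p S y := by
    rw [hval]
    obtain ⟨j, hj⟩ := Finset.nonempty_iff_ne_empty.mpr hS
    refine Finset.sum_lt_sum (fun i _ => ?_) ⟨j, Finset.mem_univ j, ?_⟩
    · split_ifs
      · linarith [hp i]
      · exact le_rfl
    · rw [if_pos hj]
      linarith [hp j]
  exact hub.trans_lt (hlt.trans_le (le_csSup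
    (isCompact_Icc.bddAbove_image (continuous_offsetPayoff p S).continuousOn)
    (Set.mem_image_of_mem _ hyY)))

/-- The one-element modular payoff with weight `(-1)^t`, independent of the second player. -/
def signPayoff (t : ℕ) (S : Finset (Fin 1)) (_ : Fin 0 → ℝ) : ℝ :=
  0 + ∑ _i ∈ S, (-1 : ℝ) ^ t

lemma lovaszG_signPayoff (t : ℕ) (x : Fin 1 → ℝ) (y : Fin 0 → ℝ) :
    lovaszG (signPayoff t) x y = (-1) ^ t * x 0 := by
  refine (lovasz_modular 0 (fun _ => (-1 : ℝ) ^ t) x).trans ?_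
  simp


/-- `SC_T` vs. action-switching count `S_T` are incomparable.
(a) There is a sequence of submodular–concave games with `SC_T = 0` and `S_T = T − 1`;
(b) there is a sequence of submodular–concave games with `S_T = 0` and `SC_T = T − 1`.
Here `a_t⋆` is the (unique) round-`t` optimal subset and `S_T` counts its changes, while
`SC_T` counts changes of the sorting permutation of the round-`t` equilibrium `x_t⋆`. -/
theorem switch_counts_incomparable (T : ℕ) (hT : 1 ≤ T) :
    -- (a) `SC_T = 0` while `S_T = T − 1`
    (∃ (n m : ℕ) (Y : Set (Fin m → ℝ)),
      IsCompact Y ∧ Convex ℝ Y ∧ Y.Nonempty ∧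
      ∃ (f : ℕ → Finset (Fin n) → (Fin m → ℝ) → ℝ)
        (xs : ℕ → Fin n → ℝ) (ys : ℕ → Fin m → ℝ) (a : ℕ → Finset (Fin n)),
        (∀ t, ∀ y ∈ Y, Submodular (fun S => f t S y)) ∧
        (∀ t, ∀ S : Finset (Fin n), ConcaveOn ℝ Y (f t S)) ∧
        (∀ t, xs t ∈ cube n ∧ ys t ∈ Y ∧
          ∀ x' ∈ cube n, ∀ y' ∈ Y,
            lovaszG (f t) (xs t) y' ≤ lovaszG (f t) (xs t) (ys t) ∧
            lovaszG (f t) (xs t) (ys t) ≤ lovaszG (f t) x' (ys t)) ∧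
        (∀ t, ∀ S : Finset (Fin n), S ≠ a t →
          sSup ((fun y => f t (a t) y) '' Y) < sSup ((fun y => f t S y) '' Y)) ∧
        ((Finset.range (T - 1)).filter
            fun t => sortPerm (xs (t + 1)) ≠ sortPerm (xs t)).card = 0 ∧
        ((Finset.range (T - 1)).filter fun t => a (t + 1) ≠ a t).card = T - 1) ∧
    -- (b) `S_T = 0` while `SC_T = T − 1`
    (∃ (n m : ℕ) (Y : Set (Fin m → ℝ)),
      IsCompact Y ∧ Convex ℝ Y ∧ Y.Nonempty ∧
      ∃ (f : ℕ → Finset (Fin n) → (Fin m → ℝ) → ℝ)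
        (xs : ℕ → Fin n → ℝ) (ys : ℕ → Fin m → ℝ) (a : ℕ → Finset (Fin n)),
        (∀ t, ∀ y ∈ Y, Submodular (fun S => f t S y)) ∧
        (∀ t, ∀ S : Finset (Fin n), ConcaveOn ℝ Y (f t S)) ∧
        (∀ t, xs t ∈ cube n ∧ ys t ∈ Y ∧
          ∀ x' ∈ cube n, ∀ y' ∈ Y,
            lovaszG (f t) (xs t) y' ≤ lovaszG (f t) (xs t) (ys t) ∧
            lovaszG (f t) (xs t) (ys t) ≤ lovaszG (f t) x' (ys t)) ∧
        (∀ t, ∀ S : Finset (Fin n), S ≠ a t →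
          sSup ((fun y => f t (a t) y) '' Y) < sSup ((fun y => f t S y) '' Y)) ∧
        ((Finset.range (T - 1)).filter fun t => a (t + 1) ≠ a t).card = 0 ∧
        ((Finset.range (T - 1)).filter
            fun t => sortPerm (xs (t + 1)) ≠ sortPerm (xs t)).card = T - 1) := by
  constructor
  · refine ⟨1, 0, Set.univ, isCompact_univ, convex_univ, Set.univ_nonempty, signPayoff,
      fun t _ => if Even t then 0 else 1, fun _ => 0, fun t => if Even t then ∅ else Finset.univ,
      fun t y _ => submodular_modular 0 _, fun t S => concaveOn_const _ convex_univ, ?_, ?_, ?_, ?_⟩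
    · refine fun t => ⟨?_, Set.mem_univ _, fun x' hx' y' _ => ?_⟩
      · constructor <;> intro i <;> by_cases h : Even t <;> simp [h]
      · have h0 : 0 ≤ x' 0 := hx'.1 0
        have h1 : x' 0 ≤ 1 := hx'.2 0
        simp only [lovaszG_signPayoff, le_refl, true_and]
        rcases Nat.even_or_odd t with h | h
        · simpa [h, h.neg_one_pow] using h0
        · simpa [Nat.not_even_iff_odd.mpr h, h.neg_one_pow] using h1
    · intro t S hS
      have hcases : S = ∅ ∨ S = Finset.univ := by
        clear hS
        revert S
        decide
      simp only [signPayoff, Set.univ_nonempty.image_const, csSup_singleton]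
      rcases Nat.even_or_odd t with h | h <;> rcases hcases with rfl | rfl
      · simp [h] at hS
      · simp [h]
      · simp [Nat.not_even_iff_odd.mpr h, h.neg_one_pow]
      · simp [Nat.not_even_iff_odd.mpr h] at hS
    · rw [Finset.card_eq_zero, Finset.filter_eq_empty_iff]
      exact fun t _ h => h (Subsingleton.elim _ _)
    · rw [Finset.filter_true_of_mem, Finset.card_range]
      intro t _
      by_cases h : Even t <;> simp [h, Nat.even_add_one]
  · have hpos : ∀ t i, 0 ≤ alternatingPoint t i := by
      intro t i
      unfold alternatingPoint
      split_ifs <;> fin_cases i <;> norm_num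
    have hhalf : ∀ t i, alternatingPoint t i < 1 / 2 := by
      intro t i
      unfold alternatingPoint
      split_ifs <;> fin_cases i <;> norm_num
    refine ⟨2, 2, Set.Icc (-1) 1, isCompact_Icc, convex_Icc _ _,
      ⟨0, by constructor <;> intro i <;> simp⟩,
      fun t => offsetPayoff (alternatingPoint t), alternatingPoint, fun _ => 0, fun _ => ∅,
      fun t y _ => submodular_modular _ y,
      fun t S => concaveOn_offsetPayoff _ S (convex_Icc _ _), ?_,
      fun t S hS => sSup_offsetPayoff_empty_lt (hpos t) (hhalf t) hS, by simp, ?_⟩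
    · refine fun t => ⟨⟨hpos t, fun i => ?_⟩, ⟨fun i => by simp, fun i => by simp⟩,
        fun x' _ y' _ => ?_⟩
      · have := hhalf t i
        simp only [Pi.one_apply]
        linarith
      · simp [lovaszG_offsetPayoff, mul_comm]
    · rw [Finset.filter_true_of_mem, Finset.card_range]
      intro t _
      apply sortPerm_ne_of_opposite_order
      by_cases h : Even t <;> simp [alternatingPoint, h, Nat.even_add_one]

end
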